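/- arXiv:1311.5878 — 2 statements merged into one kernel-verified Lean document; each statement's English description precedes it below -/
import Mathlib

section
/- Let (X, Y, π) be an irreducible factor triple and y ∈ Y right transitive. Then for x, x̄ ∈ π⁻¹(y) the following are equivalent: (1) x ~ x̄; (2) x → x̄; (3) there exists z ∈ π⁻¹(y) which is left asymptotic to x and right asymptotic to x̄. -/
open Set

universe u v uc

variable {A : Type u} {B : Type v}

/-- The shift by `n` on points of the full shift `ℤ → A`. -/
def shiftMap (n : ℤ) (x : ℤ → A) : ℤ → A := fun i => x (i + n)

/-- A subshift: a closed, shift-invariant subset of the full shift. -/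
def IsSubshift [TopologicalSpace A] (X : Set (ℤ → A)) : Prop :=
  IsClosed X ∧ ∀ n : ℤ, ∀ x ∈ X, shiftMap n x ∈ X

/-- The block `u` (of length `p`) occurs in `X`. -/
def OccursIn {p : ℕ} (u : Fin p → A) (X : Set (ℤ → A)) : Prop :=
  ∃ x ∈ X, ∃ i : ℤ, ∀ j : Fin p, x (i + (j.1 : ℤ)) = u j

/-- A shift of finite type: a subshift determined by a set of allowed `k`-blocks. -/
def IsSFT [TopologicalSpace A] (X : Set (ℤ → A)) : Prop :=
  IsSubshift X ∧ ∃ (k : ℕ) (P : (Fin k → A) → Prop),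
    X = {x | ∀ i : ℤ, P fun j => x (i + (j.1 : ℤ))}

/-- A one-step shift of finite type: determined by allowed 2-blocks. -/
def IsOneStep [TopologicalSpace A] (X : Set (ℤ → A)) : Prop :=
  IsSubshift X ∧ ∃ T : A → A → Prop, X = {x | ∀ i : ℤ, T (x i) (x (i + 1))}

/-- Irreducibility: any two blocks of `X` can be seen in a single point of `X`,
the second occurring after the first. -/
def IrreducibleSubshift [TopologicalSpace A] (X : Set (ℤ → A)) : Prop :=
  ∀ (p q : ℕ) (u : Fin p → A) (w : Fin q → A),
    OccursIn u X → OccursIn w X →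
      ∃ x ∈ X, ∃ i k : ℤ, i + (p : ℤ) ≤ k ∧
        (∀ j : Fin p, x (i + (j.1 : ℤ)) = u j) ∧ ∀ j : Fin q, x (k + (j.1 : ℤ)) = w j

/-- A sliding block code: given by a local rule on a finite window. -/
def IsSlidingBlockCode (π : (ℤ → A) → ℤ → B) : Prop :=
  ∃ (r : ℕ) (Φ : (Fin (2 * r + 1) → A) → B),
    ∀ x i, π x i = Φ fun j => x (i - (r : ℤ) + (j.1 : ℤ))

/-- A one-block code. -/
def IsOneBlock (π : (ℤ → A) → ℤ → B) : Prop :=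
  ∃ Φ : A → B, ∀ x i, π x i = Φ (x i)

/-- `Φ` is a one-block local rule for `π`. -/
def OneBlockRule (π : (ℤ → A) → ℤ → B) (Φ : A → B) : Prop :=
  ∀ x i, π x i = Φ (x i)

/-- A factor code from `X` onto `Y`. -/
def IsFactorCode (X : Set (ℤ → A)) (Y : Set (ℤ → B)) (π : (ℤ → A) → ℤ → B) : Prop :=
  IsSlidingBlockCode π ∧ (∀ x ∈ X, π x ∈ Y) ∧ ∀ y ∈ Y, ∃ x ∈ X, π x = y

/-- A factor triple: a factor code from an SFT `X` onto the subshift `Y`. -/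
def FactorTriple [TopologicalSpace A] [TopologicalSpace B]
    (X : Set (ℤ → A)) (Y : Set (ℤ → B)) (π : (ℤ → A) → ℤ → B) : Prop :=
  IsSFT X ∧ IsSubshift Y ∧ IsFactorCode X Y π

/-- Transition `x → x'`: for each `n` there is `z` in the fiber agreeing with `x`
on `(-∞, n]` and with `x'` on `[i, ∞)` for some `i ≥ n`. -/
def TransitionTo (X : Set (ℤ → A)) (π : (ℤ → A) → ℤ → B) (x x' : ℤ → A) : Prop :=
  ∀ n : ℤ, ∃ z ∈ X, π z = π x ∧ (∀ m ≤ n, z m = x m) ∧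
    ∃ i : ℤ, n ≤ i ∧ ∀ m : ℤ, i ≤ m → z m = x' m

/-- `x ~ x'`: transitions in both directions. -/
def TransEquiv (X : Set (ℤ → A)) (π : (ℤ → A) → ℤ → B) (x x' : ℤ → A) : Prop :=
  TransitionTo X π x x' ∧ TransitionTo X π x' x

/-- The transition class of `x` (within the fiber of `π x`). -/
def transClass (X : Set (ℤ → A)) (π : (ℤ → A) → ℤ → B) (x : ℤ → A) : Set (ℤ → A) :=
  {x' | x' ∈ X ∧ π x' = π x ∧ TransEquiv X π x x'}

/-- The set of transition classes over `y`. -/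
def transClassesOver (X : Set (ℤ → A)) (π : (ℤ → A) → ℤ → B) (y : ℤ → B) :
    Set (Set (ℤ → A)) :=
  {C | ∃ x, x ∈ X ∧ π x = y ∧ C = transClass X π x}

/-- Right transitive point: its forward orbit is dense in `X`. -/
def RightTransitive (X : Set (ℤ → A)) (x : ℤ → A) : Prop :=
  x ∈ X ∧ ∀ z ∈ X, ∀ N : ℕ, ∃ n : ℤ, 0 ≤ n ∧ ∀ m : ℤ, |m| ≤ (N : ℤ) → x (m + n) = z m

/-- Left transitive point: its backward orbit is dense in `X`. -/
def LeftTransitive (X : Set (ℤ → A)) (x : ℤ → A) : Prop :=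
  x ∈ X ∧ ∀ z ∈ X, ∀ N : ℕ, ∃ n : ℤ, n ≤ 0 ∧ ∀ m : ℤ, |m| ≤ (N : ℤ) → x (m + n) = z m

/-- Doubly transitive point. -/
def DoublyTransitive (X : Set (ℤ → A)) (x : ℤ → A) : Prop :=
  RightTransitive X x ∧ LeftTransitive X x

def MutuallySeparated (x x' : ℤ → A) : Prop := ∀ i : ℤ, x i ≠ x' i

def RightAsymptotic (x x' : ℤ → A) : Prop := ∃ N : ℤ, ∀ m : ℤ, N ≤ m → x m = x' m

def LeftAsymptotic (x x' : ℤ → A) : Prop := ∃ N : ℤ, ∀ m : ℤ, m ≤ N → x m = x' m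

/-- The class degree: the minimal number of transition classes over points of `Y`. -/
noncomputable def classDegree (X : Set (ℤ → A)) (Y : Set (ℤ → B))
    (π : (ℤ → A) → ℤ → B) : ℕ :=
  sInf {d | ∃ y ∈ Y, Nat.card (transClassesOver X π y) = d}

/-- The preimage blocks of a `Y`-block `w` under the one-block rule `Φ`. -/
def blockPre (X : Set (ℤ → A)) (Φ : A → B) {p : ℕ} (w : Fin p → B) : Set (Fin p → A) :=
  {u | OccursIn u X ∧ ∀ j, Φ (u j) = w j}

/-- `u ∈ π⁻¹(w)` is routable through `a` at time `n`. -/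
def Routable (X : Set (ℤ → A)) (Φ : A → B) {p : ℕ} (w : Fin (p + 1) → B)
    (u : Fin (p + 1) → A) (n : Fin (p + 1)) (a : A) : Prop :=
  ∃ u' ∈ blockPre X Φ w, u' 0 = u 0 ∧ u' (Fin.last p) = u (Fin.last p) ∧ u' n = a

/-- `(w, n, M)` is a transition block. -/
def IsTransBlock (X : Set (ℤ → A)) (Y : Set (ℤ → B)) (Φ : A → B) {p : ℕ}
    (w : Fin (p + 1) → B) (n : Fin (p + 1)) (M : Set A) : Prop :=
  OccursIn w Y ∧ 0 < n.1 ∧ n.1 < p ∧ (∀ a ∈ M, Φ a = w n) ∧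
    ∀ u ∈ blockPre X Φ w, ∃ a ∈ M, Routable X Φ w u n a

/-- `c*_π`: the minimal depth of a transition block. -/
noncomputable def minDepth (X : Set (ℤ → A)) (Y : Set (ℤ → B)) (Φ : A → B) : ℕ :=
  sInf {d | ∃ (p : ℕ) (w : Fin (p + 1) → B) (n : Fin (p + 1)) (M : Set A),
    IsTransBlock X Y Φ w n M ∧ Nat.card M = d}

/-- A minimal transition block. -/
def IsMinTransBlock (X : Set (ℤ → A)) (Y : Set (ℤ → B)) (Φ : A → B) {p : ℕ}
    (w : Fin (p + 1) → B) (n : Fin (p + 1)) (M : Set A) : Prop :=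
  IsTransBlock X Y Φ w n M ∧ Nat.card M = minDepth X Y Φ

/-- `d(w)`: the minimal number of symbols seen at a single coordinate among
the preimages of `w`. -/
noncomputable def dval (X : Set (ℤ → A)) (Φ : A → B) {p : ℕ} (w : Fin p → B) : ℕ :=
  sInf {m | ∃ k : Fin p, Nat.card {a : A | ∃ u ∈ blockPre X Φ w, u k = a} = m}

/-- A magic block: a block of `Y` minimizing `d(·)`. -/
def IsMagicBlock (X : Set (ℤ → A)) (Y : Set (ℤ → B)) (Φ : A → B) {p : ℕ}
    (w : Fin (p + 1) → B) : Prop :=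
  OccursIn w Y ∧
    dval X Φ w = sInf {m | ∃ (q : ℕ) (v : Fin (q + 1) → B), OccursIn v Y ∧ dval X Φ v = m}

/-- An `(X̄, v̄)`-diamond: blocks `u, v` of `X` with the same image, same
endpoints, `u` occurring in `X̄` and `v̄` a subblock of `v`. -/
def IsDiamond (X Xbar : Set (ℤ → A)) (Φ : A → B) {q p : ℕ} (vbar : Fin q → A)
    (u v : Fin (p + 1) → A) : Prop :=
  OccursIn u Xbar ∧ OccursIn v X ∧ (∀ j, Φ (u j) = Φ (v j)) ∧
    (∃ (s : ℕ) (_ : s + q ≤ p + 1), ∀ j : Fin q,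
      v ⟨s + j.1, by have := j.2; omega⟩ = vbar j) ∧
    u 0 = v 0 ∧ u (Fin.last p) = v (Fin.last p)

/-- Reversed transition `x →_r x'`. -/
def RevTransitionTo (X : Set (ℤ → A)) (π : (ℤ → A) → ℤ → B) (x x' : ℤ → A) : Prop :=
  ∀ n : ℤ, ∃ z ∈ X, π z = π x ∧ (∀ m : ℤ, n ≤ m → z m = x' m) ∧
    ∃ i : ℤ, i ≤ n ∧ ∀ m ≤ i, z m = x m

def RevTransEquiv (X : Set (ℤ → A)) (π : (ℤ → A) → ℤ → B) (x x' : ℤ → A) : Prop :=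
  RevTransitionTo X π x x' ∧ RevTransitionTo X π x' x

/-- The reversed transition class of `x`. -/
def revClass (X : Set (ℤ → A)) (π : (ℤ → A) → ℤ → B) (x : ℤ → A) : Set (ℤ → A) :=
  {x' | x' ∈ X ∧ π x' = π x ∧ RevTransEquiv X π x x'}

open scoped Classical in
/-- The standard metric on the full shift. -/
noncomputable def shiftDist (x x' : ℤ → A) : ℝ :=
  if x = x' then 0
  else
    let k : ℕ := sInf {k : ℕ | x (k : ℤ) ≠ x' (k : ℤ) ∨ x (-(k : ℤ)) ≠ x' (-(k : ℤ))}
    (2 : ℝ) ^ (-(k : ℤ))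

/-! ### Finite monoids and labelled graphs -/

lemma aux_idem_pow {M : Type*} [Monoid M] [Finite M] (g : M) :
    ∃ k : ℕ, 0 < k ∧ g ^ k * g ^ k = g ^ k := by
  obtain ⟨i, j, hij, h⟩ := Finite.exists_ne_map_eq_of_infinite (fun n : ℕ => g ^ n)
  wlog hlt : i < j generalizing i j
  · exact this j i hij.symm h.symm (by omega)
  obtain ⟨d, rfl⟩ := Nat.exists_eq_add_of_lt hlt
  have h1 : ∀ n, i ≤ n → g ^ (n + (d + 1)) = g ^ n := by
    intro n hn
    obtain ⟨m, rfl⟩ := Nat.exists_eq_add_of_le hn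
    have : i + m + (d + 1) = (i + d + 1) + m := by omega
    rw [this, pow_add, ← h, ← pow_add]
  have h2 : ∀ t n, i ≤ n → g ^ (n + t * (d + 1)) = g ^ n := by
    intro t
    induction t with
    | zero => intro n _; simp
    | succ t ih =>
      intro n hn
      have : n + (t + 1) * (d + 1) = (n + t * (d + 1)) + (d + 1) := by ring
      rw [this, h1 _ (by omega), ih n hn]
  refine ⟨(i + 1) * (d + 1), by positivity, ?_⟩
  rw [← pow_add]
  exact h2 (i + 1) _ (by nlinarith)

/-- Path relation of a labelled graph. -/
def pathRel {Q : Type*} (E : Q → B → Q → Prop) : List B → Q → Q → Prop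
  | [], s, t => s = t
  | b :: l, s, t => ∃ q, E s b q ∧ pathRel E l q t

lemma pathRel_append {Q : Type*} (E : Q → B → Q → Prop) (l l' : List B) (s t : Q) :
    pathRel E (l ++ l') s t ↔ ∃ q, pathRel E l s q ∧ pathRel E l' q t := by
  induction l generalizing s with
  | nil => simp [pathRel]
  | cons b l ih =>
    simp only [List.cons_append, pathRel, ih]
    constructor
    · rintro ⟨q, h1, q', h2, h3⟩; exact ⟨q', ⟨q, h1, h2⟩, h3⟩
    · rintro ⟨q', ⟨q, h1, h2⟩, h3⟩; exact ⟨q, h1, q', h2, h3⟩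

/-- Action of words on sets of states. -/
def wordAct {Q : Type*} (E : Q → B → Q → Prop) (l : List B) : Function.End (Set Q) :=
  fun S => {t | ∃ s ∈ S, pathRel E l s t}

lemma wordAct_append {Q : Type*} (E : Q → B → Q → Prop) (l l' : List B) :
    wordAct E (l ++ l') = wordAct E l' * wordAct E l := by
  funext S
  ext t
  change (∃ s ∈ S, pathRel E (l ++ l') s t) ↔
    ∃ q, (∃ s ∈ S, pathRel E l s q) ∧ pathRel E l' q t
  simp only [pathRel_append]
  constructor
  · rintro ⟨s, hs, q, h1, h2⟩; exact ⟨q, ⟨s, hs, h1⟩, h2⟩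
  · rintro ⟨q, ⟨s, hs, h1⟩, h2⟩; exact ⟨s, hs, q, h1, h2⟩

lemma wordAct_nil {Q : Type*} (E : Q → B → Q → Prop) :
    wordAct E [] = 1 := by
  funext S
  ext t
  change (∃ s ∈ S, s = t) ↔ t ∈ S
  simp

lemma pathRel_iff_wordAct {Q : Type*} (E : Q → B → Q → Prop) (l : List B) (s t : Q) :
    pathRel E l s t ↔ t ∈ wordAct E l {s} := by
  change _ ↔ ∃ q ∈ ({s} : Set Q), pathRel E l q t
  simp

lemma pathRel_congr {Q : Type*} {E : Q → B → Q → Prop} {l l' : List B}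
    (h : wordAct E l = wordAct E l') (s t : Q) : pathRel E l s t ↔ pathRel E l' s t := by
  rw [pathRel_iff_wordAct, pathRel_iff_wordAct, h]

/-- Repetition of a word. -/
def wordPow (l : List B) : ℕ → List B
  | 0 => []
  | k + 1 => l ++ wordPow l k

lemma wordAct_pow {Q : Type*} (E : Q → B → Q → Prop) (l : List B) (k : ℕ) :
    wordAct E (wordPow l k) = wordAct E l ^ k := by
  induction k with
  | zero => simp [wordPow, wordAct_nil]
  | succ k ih => rw [wordPow, wordAct_append, ih, pow_succ]

lemma pathRel_pow_refl {Q : Type*} (E : Q → B → Q → Prop) (l : List B) (a : Q)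
    (h : pathRel E l a a) (k : ℕ) : pathRel E (wordPow l k) a a := by
  induction k with
  | zero => simp [wordPow, pathRel]
  | succ k ih => rw [wordPow, pathRel_append]; exact ⟨a, h, ih⟩

lemma pathRel_pow_of {Q : Type*} (E : Q → B → Q → Prop) (l : List B) (a b : Q)
    (h : pathRel E l a a) (h' : pathRel E l a b) (k : ℕ) (hk : 0 < k) :
    pathRel E (wordPow l k) a b := by
  induction k with
  | zero => omega
  | succ k ih =>
    rw [wordPow, pathRel_append]
    rcases Nat.eq_zero_or_pos k with rfl | hk'
    · exact ⟨b, h', by simp [wordPow, pathRel]⟩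
    · exact ⟨a, h, ih hk'⟩

/-- Existence of a minimal idempotent word. -/
lemma exists_min_word {Q : Type*} [Finite Q] (E : Q → B → Q → Prop) (O : Q → Prop)
    (hne : ∃ l s, O s ∧ pathRel E l s s) :
    ∃ w c, O c ∧ pathRel E w c c ∧
      (∀ a b, pathRel E w a b ↔ ∃ q, pathRel E w a q ∧ pathRel E w q b) ∧
      ∀ v a b, O a → pathRel E (w ++ (v ++ w)) a a → pathRel E (w ++ (v ++ w)) a b →
        pathRel E w a b := by
  classical
  haveI : Finite (Function.End (Set Q)) := inferInstanceAs (Finite (Set Q → Set Q))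
  let good : List B → Prop := fun w =>
    (∃ c, O c ∧ pathRel E w c c) ∧ wordAct E w * wordAct E w = wordAct E w
  have hgood : ∃ n : ℕ, ∃ w, good w ∧ (Set.range (wordAct E w)).ncard = n := by
    obtain ⟨l, s, hs, hl⟩ := hne
    obtain ⟨k, hk, hk'⟩ := aux_idem_pow (wordAct E l)
    refine ⟨_, wordPow l k, ⟨⟨s, hs, pathRel_pow_refl E l s hl k⟩, ?_⟩, rfl⟩
    rw [wordAct_pow]; exact hk'
  obtain ⟨w, hw, hwn⟩ := Nat.find_spec hgood
  have hmin : ∀ w', good w' →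
      (Set.range (wordAct E w)).ncard ≤ (Set.range (wordAct E w')).ncard := by
    intro w' hw'
    rw [hwn]
    exact Nat.find_min' hgood ⟨w', hw', rfl⟩
  obtain ⟨⟨c, hc, hcc⟩, hid⟩ := hw
  refine ⟨w, c, hc, hcc, ?_, ?_⟩
  · intro a b
    rw [← pathRel_append]
    exact pathRel_congr (by rw [wordAct_append, hid]) a b
  · intro v a b ha haa hab
    set g := w ++ (v ++ w) with hg
    obtain ⟨k, hk, hk'⟩ := aux_idem_pow (wordAct E g)
    have heg : wordAct E w * wordAct E g = wordAct E g := by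
      rw [hg, wordAct_append, wordAct_append, ← mul_assoc, ← mul_assoc, hid]
    have hge : wordAct E g * wordAct E w = wordAct E g := by
      rw [hg, wordAct_append, mul_assoc, hid]
    obtain ⟨m, rfl⟩ : ∃ m, k = m + 1 := ⟨k - 1, by omega⟩
    have hef : wordAct E w * wordAct E g ^ (m + 1) = wordAct E g ^ (m + 1) := by
      rw [pow_succ', ← mul_assoc, heg]
    have hfe : wordAct E g ^ (m + 1) * wordAct E w = wordAct E g ^ (m + 1) := by
      rw [pow_succ, mul_assoc, hge]
    have hgoodf : good (wordPow g (m + 1)) := by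
      refine ⟨⟨a, ha, pathRel_pow_refl E g a haa _⟩, ?_⟩
      rw [wordAct_pow]; exact hk'
    have hle := hmin _ hgoodf
    rw [wordAct_pow] at hle
    have hsub : Set.range (wordAct E g ^ (m + 1)) ⊆ Set.range (wordAct E w) := by
      rintro _ ⟨S, rfl⟩
      refine ⟨(wordAct E g ^ (m + 1)) S, ?_⟩
      exact congrFun hef S
    have heq := Set.eq_of_subset_of_ncard_le hsub hle (Set.toFinite _)
    have hfinal : wordAct E (wordPow g (m + 1)) = wordAct E w := by
      rw [wordAct_pow]
      rw [← hfe]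
      funext S
      have : wordAct E w S ∈ Set.range (wordAct E g ^ (m + 1)) := by
        rw [heq]; exact ⟨S, rfl⟩
      obtain ⟨S', hS'⟩ := this
      change (wordAct E g ^ (m + 1)) (wordAct E w S) = wordAct E w S
      rw [← hS']
      exact congrFun hk' S'
    exact (pathRel_congr hfinal a b).1 (pathRel_pow_of E g a b haa hab _ hk)

lemma exists_refl_between {Q : Type*} [Finite Q] (e : Q → Q → Prop)
    (he : ∀ a b, e a b ↔ ∃ q, e a q ∧ e q b) (a b : Q) (hab : e a b) :
    ∃ c, e a c ∧ e c c ∧ e c b := by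
  by_contra hcon
  push Not at hcon
  let S := {q : Q // e a q ∧ e q b}
  let r : S → S → Prop := fun p q => e p.1 q.1
  haveI : IsTrans S r := ⟨fun p q t h1 h2 => (he _ _).2 ⟨q.1, h1, h2⟩⟩
  haveI : Std.Irrefl r := ⟨fun p h => hcon p.1 p.2.1 h p.2.2⟩
  have wf := Finite.wellFounded_of_trans_of_irrefl r
  obtain ⟨q0, h0⟩ := (he a b).1 hab
  obtain ⟨m, -, hm⟩ := wf.has_min Set.univ ⟨(⟨q0, h0⟩ : S), trivial⟩
  obtain ⟨q, hq1, hq2⟩ := (he _ _).1 m.2.1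
  exact hm ⟨q, hq1, (he _ _).2 ⟨m.1, hq2, m.2.2⟩⟩ trivial hq2

/-! ### Windows, words and gluing -/

/-- Window of length `L` at position `p`. -/
def win (L : ℕ) (x : ℤ → A) (p : ℤ) : Fin L → A := fun j => x (p + (j.1 : ℤ))

lemma win_eq_iff {L : ℕ} {x z : ℤ → A} {p q : ℤ} :
    win L x p = win L z q ↔ ∀ j : ℕ, j < L → x (p + j) = z (q + j) := by
  constructor
  · intro h j hj; exact congrFun h ⟨j, hj⟩
  · intro h; funext j; exact h j.1 j.2

/-- Word of length `m` read from position `p`. -/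
def wd (y : ℤ → B) (p : ℤ) : ℕ → List B
  | 0 => []
  | m + 1 => y p :: wd y (p + 1) m

lemma wd_eq_iff (y y' : ℤ → B) (p p' : ℤ) (m : ℕ) :
    wd y p m = wd y' p' m ↔ ∀ j : ℕ, j < m → y (p + j) = y' (p' + j) := by
  induction m generalizing p p' with
  | zero => simp [wd]
  | succ m ih =>
    simp only [wd, List.cons.injEq, ih]
    constructor
    · rintro ⟨h0, h⟩ j hj
      rcases j with _ | j
      · simpa using h0
      · have := h j (by omega)
        push_cast
        rw [show p + ((j : ℤ) + 1) = p + 1 + j by ring,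
          show p' + ((j : ℤ) + 1) = p' + 1 + j by ring]
        exact this
    · intro h
      refine ⟨by simpa using h 0 (by omega), fun j hj => ?_⟩
      have := h (j + 1) (by omega)
      push_cast at this
      rw [show p + ((j : ℤ) + 1) = p + 1 + j by ring,
          show p' + ((j : ℤ) + 1) = p' + 1 + j by ring] at this
      exact this

/-- Edges of the labelled graph presenting `X` and `π`. -/
def edgeRel (X : Set (ℤ → A)) (π : (ℤ → A) → ℤ → B) (L r : ℕ)
    (s : Fin L → A) (b : B) (t : Fin L → A) : Prop :=
  ∃ x ∈ X, win L x 0 = s ∧ win L x 1 = t ∧ π x r = b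

/-- Locality package. -/
structure LocalData (X : Set (ℤ → A)) (π : (ℤ → A) → ℤ → B) (L r : ℕ) : Prop where
  pos : 1 ≤ L
  shift : ∀ n : ℤ, ∀ x ∈ X, shiftMap n x ∈ X
  shiftπ : ∀ (n : ℤ) (x : ℤ → A) (i : ℤ), π (shiftMap n x) i = π x (i + n)
  splice : ∀ (x z : ℤ → A) (p : ℤ), x ∈ X → z ∈ X → win L x p = win L z p →
    ∃ w ∈ X, (∀ i < p + L, w i = x i) ∧ (∀ i, p ≤ i → w i = z i) ∧
      (∀ i < p + r, π w i = π x i) ∧ (∀ i, p + r ≤ i → π w i = π z i)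

lemma exists_localData [TopologicalSpace A] (X : Set (ℤ → A)) (π : (ℤ → A) → ℤ → B)
    (hX : IsSFT X) (hπ : IsSlidingBlockCode π) : ∃ L r, LocalData X π L r := by
  obtain ⟨⟨-, hsh⟩, k, P, hP⟩ := hX
  obtain ⟨r, Φ, hΦ⟩ := hπ
  refine ⟨k + 2 * r + 1, r, by omega, hsh, ?_, ?_⟩
  · intro n x i
    rw [hΦ, hΦ]
    congr 1
    funext j
    simp only [shiftMap]
    congr 1
    ring
  · intro x z p hx hz hxz
    rw [win_eq_iff] at hxz
    have h1 : ∀ i < p + ((k + 2 * r + 1 : ℕ) : ℤ), (if i < p then x i else z i) = x i := by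
      intro i hi
      split_ifs with h
      · rfl
      · have := hxz (i - p).toNat (by omega)
        rw [show p + (((i - p).toNat : ℕ) : ℤ) = i by omega] at this
        exact this.symm
    have h2 : ∀ i, p ≤ i → (if i < p then x i else z i) = z i := by
      intro i hi
      rw [if_neg (by omega)]
    refine ⟨fun i => if i < p then x i else z i, ?_, h1, h2, ?_, ?_⟩
    · rw [hP] at hx hz ⊢
      intro i
      rcases lt_or_ge i p with hi | hi
      · convert hx i using 2 with j
        exact h1 _ (by have := j.2; push_cast; omega)
      · convert hz i using 2 with j
        exact h2 _ (by omega)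
    · intro i hi
      rw [hΦ, hΦ]
      congr 1
      funext j
      exact h1 _ (by have := j.2; push_cast; omega)
    · intro i hi
      rw [hΦ, hΦ]
      congr 1
      funext j
      exact h2 _ (by omega)

section
variable {X : Set (ℤ → A)} {π : (ℤ → A) → ℤ → B} {L r : ℕ}

lemma win_shift (n p : ℤ) (x : ℤ → A) : win L (shiftMap n x) p = win L x (p + n) := by
  funext j
  simp only [win, shiftMap]
  congr 1
  ring

lemma edgeRel_of_point (H : LocalData X π L r) {x : ℤ → A} (hx : x ∈ X) (p : ℤ) :
    edgeRel X π L r (win L x p) (π x (p + r)) (win L x (p + 1)) := by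
  refine ⟨shiftMap p x, H.shift p x hx, ?_, ?_, ?_⟩
  · rw [win_shift, zero_add]
  · rw [win_shift, add_comm]
  · rw [H.shiftπ, add_comm]

lemma pathRel_of_point (H : LocalData X π L r) {x : ℤ → A} (hx : x ∈ X) (p : ℤ) (m : ℕ) :
    pathRel (edgeRel X π L r) (wd (π x) (p + r) m) (win L x p) (win L x (p + m)) := by
  induction m generalizing p with
  | zero => simp [wd, pathRel]
  | succ m ih =>
    refine ⟨_, edgeRel_of_point H hx p, ?_⟩
    have := ih (p + 1)
    rw [show p + 1 + (r : ℤ) = p + r + 1 by ring,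
      show p + 1 + (m : ℤ) = p + ((m + 1 : ℕ) : ℤ) by push_cast; ring] at this
    exact this

/-- The state occurs in `X`. -/
def occState (X : Set (ℤ → A)) (L : ℕ) (s : Fin L → A) : Prop := ∃ x ∈ X, ∃ p, win L x p = s

lemma occState_of_path {l : List B} {s t : Fin L → A}
    (h : pathRel (edgeRel X π L r) l s t) (hs : occState X L s) : occState X L t := by
  induction l generalizing s with
  | nil => cases h; exact hs
  | cons b l ih =>
    obtain ⟨q, ⟨x, hx, -, hq, -⟩, h2⟩ := h
    exact ih h2 ⟨x, hx, 1, hq⟩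

lemma glue (H : LocalData X π L r) (l : List B) (x z : ℤ → A) (p : ℤ) (hx : x ∈ X)
    (hz : z ∈ X)
    (h : pathRel (edgeRel X π L r) l (win L x p) (win L z (p + l.length))) :
    ∃ w ∈ X, (∀ i < p + L, w i = x i) ∧ (∀ i, p + l.length ≤ i → w i = z i) ∧
      (∀ i < p + r, π w i = π x i) ∧ (∀ i, p + l.length + r ≤ i → π w i = π z i) ∧
      wd (π w) (p + r) l.length = l := by
  induction l generalizing x p with
  | nil =>
    simp only [List.length_nil, Nat.cast_zero, add_zero] at h ⊢
    obtain ⟨w, h1, h2, h3, h4, h5⟩ := H.splice x z p hx hz h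
    exact ⟨w, h1, h2, h3, h4, h5, rfl⟩
  | cons b l ih =>
    obtain ⟨q, ⟨x1, hx1, hs, hq, hb⟩, hl⟩ := h
    obtain ⟨x2, hx2, a1, a2, a3, a4⟩ := H.splice x (shiftMap (-p) x1) p hx
      (H.shift _ _ hx1) (by rw [win_shift, add_neg_cancel, hs])
    have hw2 : win L x2 (p + 1) = q := by
      rw [← hq]
      rw [win_eq_iff]
      intro j hj
      rw [a2 _ (by omega)]
      simp only [shiftMap]
      congr 1
      ring
    have hlen : p + ((b :: l).length : ℤ) = p + 1 + l.length := by
      simp only [List.length_cons]; push_cast; ring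
    rw [hlen] at hl ⊢
    obtain ⟨w, hw, b1, b2, b3, b4, b5⟩ := ih x2 (p + 1) hx2 (by rw [hw2]; exact hl)
    refine ⟨w, hw, ?_, b2, ?_, b4, ?_⟩
    · intro i hi
      rw [b1 i (by omega), a1 i hi]
    · intro i hi
      rw [b3 i (by omega), a3 i hi]
    · simp only [List.length_cons, wd, List.cons.injEq]
      constructor
      · rw [b3 _ (by omega), a4 _ (by omega), H.shiftπ]
        rw [← hb]
        congr 1
        ring
      · rw [show p + (r : ℤ) + 1 = p + 1 + r by ring]
        exact b5

lemma exists_path_of_irr [TopologicalSpace A] (H : LocalData X π L r)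
    (hirr : IrreducibleSubshift X) {s t : Fin L → A} (hs : occState X L s)
    (ht : occState X L t) : ∃ l, pathRel (edgeRel X π L r) l s t := by
  obtain ⟨x, hx, p, rfl⟩ := hs
  obtain ⟨z, hz, q, rfl⟩ := ht
  obtain ⟨w, hw, i, k, hik, h1, h2⟩ := hirr L L (win L x p) (win L z q)
    ⟨x, hx, p, fun _ => rfl⟩ ⟨z, hz, q, fun _ => rfl⟩
  refine ⟨wd (π w) (i + r) (k - i).toNat, ?_⟩
  have := pathRel_of_point H hw i (k - i).toNat
  rw [show i + (((k - i).toNat : ℕ) : ℤ) = k by omega] at this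
  have e1 : win L w i = win L x p := funext h1
  have e2 : win L w k = win L z q := funext h2
  rwa [e1, e2] at this

lemma recur_word [TopologicalSpace B] {Y : Set (ℤ → B)} (hY : IsSubshift Y) {y : ℤ → B}
    (hy : RightTransitive Y y) {y' : ℤ → B} (hy' : y' ∈ Y) (q : ℤ) (m : ℕ) (M : ℤ) :
    ∃ p, M ≤ p ∧ wd y p m = wd y' q m := by
  obtain ⟨n, hn, h⟩ := hy.2 (shiftMap (q - |M|) y') (hY.2 _ _ hy') (M.natAbs + m)
  have hM := le_abs_self M
  have hM0 := abs_nonneg M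
  refine ⟨|M| + n, by omega, ?_⟩
  rw [wd_eq_iff]
  intro j hj
  have := h (|M| + j) (by rw [abs_of_nonneg (by omega)]; push_cast; omega)
  rw [show |M| + n + (j : ℤ) = |M| + j + n by ring, this]
  simp only [shiftMap]
  congr 1
  ring

lemma main_transition [Finite A] [TopologicalSpace A] [TopologicalSpace B] {Y : Set (ℤ → B)}
    (H : LocalData X π L r) (hirr : IrreducibleSubshift X) (hY : IsSubshift Y)
    (hXY : ∀ x ∈ X, π x ∈ Y) {y : ℤ → B} (hy : RightTransitive Y y)
    {x z : ℤ → A} (hx : x ∈ X) (hz : z ∈ X) (hpx : π x = y) (hpz : π z = y) (N : ℤ)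
    (hN : win L x N = win L z N) : TransitionTo X π x z := by
  intro n
  have hO : ∀ {x : ℤ → A}, x ∈ X → ∀ p, occState X L (win L x p) :=
    fun {x} hx p => ⟨x, hx, p, rfl⟩
  obtain ⟨w, c, hc, hcc, hid, hmin⟩ := exists_min_word (edgeRel X π L r) (occState X L)
    (by
      obtain ⟨l, hl⟩ := exists_path_of_irr H hirr (hO hx 0) (hO hx 0)
      exact ⟨l, _, hO hx 0, hl⟩)
  -- the word `w` occurs in `Y`
  obtain ⟨y', hy', q, hq⟩ : ∃ y' ∈ Y, ∃ q, wd y' q w.length = w := by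
    obtain ⟨a, ha, p, rfl⟩ := hc
    obtain ⟨v, hv, -, -, -, -, h⟩ := glue H w a (shiftMap (-w.length) a) p ha
      (H.shift _ _ ha) (by rw [win_shift, add_neg_cancel_right]; exact hcc)
    exact ⟨π v, hXY v hv, _, h⟩
  obtain ⟨p', hp', hw'⟩ := recur_word hY hy hy' q w.length (max n N + r)
  obtain ⟨p, rfl⟩ : ∃ p, p' = p + r := ⟨p' - r, by ring⟩
  have hpn : n ≤ p := by have := le_max_left n N; omega
  have hpN : N ≤ p := by have := le_max_right n N; omega
  rw [hq] at hw'
  have path : ∀ {x : ℤ → A}, x ∈ X → π x = y →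
      pathRel (edgeRel X π L r) w (win L x p) (win L x (p + w.length)) := by
    intro x hx hpx
    have := pathRel_of_point H hx p w.length
    rwa [hpx, hw'] at this
  have path0 : ∀ {x : ℤ → A}, x ∈ X → π x = y →
      pathRel (edgeRel X π L r) (wd y (N + r) (p - N).toNat) (win L x N) (win L x p) := by
    intro x hx hpx
    have := pathRel_of_point H hx N (p - N).toNat
    rwa [hpx, show N + (((p - N).toNat : ℕ) : ℤ) = p by omega] at this
  obtain ⟨c1, h11, h12, h13⟩ := exists_refl_between _ hid _ _ (path hx hpx)
  obtain ⟨c2, h21, h22, h23⟩ := exists_refl_between _ hid _ _ (path hz hpz)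
  have hc1 : occState X L c1 := occState_of_path h11 (hO hx p)
  obtain ⟨v, hv⟩ := exists_path_of_irr H hirr hc1 (hO hx N)
  have hloop : ∀ d, (∃ q, pathRel (edgeRel X π L r) (wd y (N + r) (p - N).toNat) (win L x N) q ∧
      pathRel (edgeRel X π L r) w q d) →
      pathRel (edgeRel X π L r) (w ++ ((v ++ wd y (N + r) (p - N).toNat) ++ w)) c1 d := by
    rintro d ⟨q, hq1, hq2⟩
    simp only [pathRel_append]
    exact ⟨c1, h12, q, ⟨_, hv, hq1⟩, hq2⟩
  have h1c := hmin _ c1 c2 hc1 (hloop c1 ⟨_, path0 hx hpx, h11⟩)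
    (hloop c2 ⟨win L z p, by rw [hN]; exact path0 hz hpz, h21⟩)
  have hfin : pathRel (edgeRel X π L r) w (win L x p) (win L z (p + w.length)) :=
    (hid _ _).2 ⟨c1, h11, (hid _ _).2 ⟨c2, h1c, h23⟩⟩
  obtain ⟨t, ht, t1, t2, t3, t4, t5⟩ := glue H w x z p hx hz hfin
  have hLpos := H.pos
  refine ⟨t, ht, ?_, fun m hm => t1 m (by omega), p + w.length, by omega, t2⟩
  funext i
  rcases lt_or_ge i (p + r) with hi | hi
  · exact t3 i hi
  · rcases lt_or_ge i (p + w.length + r) with hi' | hi'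
    · rw [hpx]
      have := (wd_eq_iff (π t) y (p + r) (p + r) w.length).1 (t5.trans hw'.symm)
        (i - (p + r)).toNat (by omega)
      rwa [show p + (r : ℤ) + (((i - (p + r)).toNat : ℕ) : ℤ) = i by omega] at this
    · rw [t4 i hi', hpz, hpx]

end

theorem transition_equals_equivalence [Fintype A] [TopologicalSpace A] [DiscreteTopology A]
    [Fintype B] [TopologicalSpace B] [DiscreteTopology B]
    (X : Set (ℤ → A)) (Y : Set (ℤ → B)) (π : (ℤ → A) → ℤ → B)
    (hT : FactorTriple X Y π) (hXirr : IrreducibleSubshift X)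
    (y : ℤ → B) (hy : RightTransitive Y y)
    (x x' : ℤ → A) (hx : x ∈ X) (hx' : x' ∈ X)
    (hpx : π x = y) (hpx' : π x' = y) :
    (TransEquiv X π x x' ↔ TransitionTo X π x x') ∧
    (TransEquiv X π x x' ↔
      ∃ z ∈ X, π z = y ∧ LeftAsymptotic z x ∧ RightAsymptotic z x') := by
  obtain ⟨hSFT, hY, hcode, hXY, -⟩ := hT
  obtain ⟨L, r, H⟩ := exists_localData X π hSFT hcode
  have key : (∃ z ∈ X, π z = y ∧ LeftAsymptotic z x ∧ RightAsymptotic z x') →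
      TransEquiv X π x x' := by
    rintro ⟨z, hz, hpz, ⟨N, hN⟩, ⟨N', hN'⟩⟩
    have hwin : win L x (N - L) = win L z (N - L) := by
      rw [win_eq_iff]
      intro j hj
      exact (hN _ (by omega)).symm
    have h1 := main_transition H hXirr hY hXY hy hx hz hpx hpz _ hwin
    have h2 := main_transition H hXirr hY hXY hy hz hx hpz hpx _ hwin.symm
    constructor
    · intro n
      obtain ⟨t, ht, hpt, ht1, i, hi, ht2⟩ := h1 n
      refine ⟨t, ht, hpt, ht1, max i N', le_trans hi (le_max_left _ _), fun m hm => ?_⟩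
      rw [ht2 m (le_trans (le_max_left _ _) hm), hN' m (le_trans (le_max_right _ _) hm)]
    · intro n
      obtain ⟨t, ht, hpt, ht1, i, hi, ht2⟩ := h2 (max n N' + L)
      have hnm := le_max_left n N'
      have hnm' := le_max_right n N'
      obtain ⟨w, hw, w1, w2, w3, w4⟩ := H.splice x' t (max n N') hx' ht (by
        rw [win_eq_iff]
        intro j hj
        rw [ht1 _ (by omega), hN' _ (by omega)])
      have hLpos := H.pos
      refine ⟨w, hw, ?_, fun m hm => w1 m (by omega), i, by omega, fun m hm => ?_⟩
      · funext m
        rcases lt_or_ge m (max n N' + r) with hm | hm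
        · exact w3 m hm
        · rw [w4 m hm, hpt, hpz, hpx']
      · rw [w2 m (by omega), ht2 m hm]
  have h23 : TransitionTo X π x x' →
      ∃ z ∈ X, π z = y ∧ LeftAsymptotic z x ∧ RightAsymptotic z x' := by
    intro h
    obtain ⟨z, hz, hpz, h1, i, -, h2⟩ := h 0
    exact ⟨z, hz, hpz.trans hpx, ⟨0, h1⟩, ⟨i, h2⟩⟩
  exact ⟨⟨fun h => h.1, fun h => key (h23 h)⟩, ⟨fun h => h23 h.1, key⟩⟩
end

section
/- Let (X, Y, π) be an irreducible factor triple and y ∈ Y a right transitive point whose coordinates y_{(-∞,0)} contain an occurrence of a minimal transition block. Then for any right transitive point z ∈ Y with z_i = y_0 and any transition class D over z, the set D|_i = { x_i : x ∈ D } intersects C|_0 for at most one transition class C over y. -/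
open Set

universe u v uc

variable {A : Type u} {B : Type v}

theorem rel_idem_refl {M : Type*} [Finite M] (E : M → M → Prop) (hE : Relation.Comp E E = E)
    {a b : M} (h : E a b) : ∃ c, E a c ∧ E c c ∧ E c b := by
  have htr : ∀ {x y z}, E x y → E y z → E x z := by
    intro x y z h1 h2
    rw [← hE]; exact ⟨y, h1, h2⟩
  have hd : ∀ {x y}, E x y → ∃ z, E x z ∧ E z y := by
    intro x y h1
    rw [← hE] at h1; exact h1
  by_contra hcon
  push Not at hcon
  let S := {x : M // E a x ∧ E x b}
  let r : S → S → Prop := fun x y => E x.1 y.1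
  have : IsTrans S r := ⟨fun x y z h1 h2 => htr h1 h2⟩
  have : Std.Irrefl r := ⟨fun x h1 => hcon x.1 x.2.1 h1 x.2.2⟩
  have wf : WellFounded r := Finite.wellFounded_of_trans_of_irrefl r
  obtain ⟨z, hz1, hz2⟩ := hd h
  obtain ⟨m, -, hm⟩ := wf.has_min Set.univ ⟨⟨z, hz1, hz2⟩, trivial⟩
  obtain ⟨z', h1, h2⟩ := hd m.2.1
  exact hm ⟨z', h1, htr h2 m.2.2⟩ trivial h2

theorem rel_exists_idem {M : Type*} [Finite M] (P : Set (M → M → Prop)) (hne : P.Nonempty)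
    (hc : ∀ R ∈ P, ∀ S ∈ P, Relation.Comp R S ∈ P) : ∃ E ∈ P, Relation.Comp E E = E := by
  let : Semigroup (M → M → Prop) :=
    { mul := Relation.Comp, mul_assoc := fun a b c => Relation.comp_assoc }
  let : TopologicalSpace (M → M → Prop) := ⊥
  have : DiscreteTopology (M → M → Prop) := ⟨rfl⟩
  obtain ⟨E, h1, h2⟩ := exists_idempotent_in_compact_subsemigroup
    (fun r : M → M → Prop => continuous_of_discreteTopology) P hne
    (Set.toFinite P).isCompact (fun x hx y hy => hc x hx y hy)
  exact ⟨E, h1, h2⟩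

theorem rel_abs {M : Type*} [Finite M] (P : Set (M → M → Prop))
    (hc : ∀ R ∈ P, ∀ S ∈ P, Relation.Comp R S ∈ P)
    (hs : ∀ R ∈ P, ∀ S ∈ P, ∀ b, ∃ a c, R a b ∧ S b c ∧ ∀ b', R a b' → S b' c → b' = b)
    (hi : ∀ a b, ∃ R ∈ P, R a b) :
    ∀ R ∈ P, (∀ a a' b, R a b → R a' b → a = a') ∧ (∀ a b b', R a b → R a b' → b = b') := by
  classical
  have hrefl : ∀ E ∈ P, Relation.Comp E E = E → ∀ b, E b b := by
    intro E hE hEE b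
    obtain ⟨a, c, h1, h2, h3⟩ := hs E hE E hE b
    obtain ⟨b', h4, h5, h6⟩ := rel_idem_refl E hEE h1
    have : E b' c := by rw [← hEE]; exact ⟨b, h6, h2⟩
    have := h3 b' h4 this
    subst this; exact h5
  have hanti : ∀ E ∈ P, Relation.Comp E E = E → ∀ b b', E b b' → E b' b → b = b' := by
    intro E hE hEE b b' h h'
    obtain ⟨a, c, h1, h2, h3⟩ := hs E hE E hE b
    refine (h3 b' ?_ ?_).symm
    · rw [← hEE]; exact ⟨b, h1, h⟩
    · rw [← hEE]; exact ⟨b, h', h2⟩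
  have hperm : ∀ R ∈ P, ∃ σ : Equiv.Perm M, ∀ a, R a (σ a) := by
    intro R hR
    obtain ⟨E, ⟨S, hS, rfl⟩, hEE⟩ := rel_exists_idem {E | ∃ S ∈ P, E = Relation.Comp R S}
      ⟨_, R, hR, rfl⟩ (by
        rintro _ ⟨S, hS, rfl⟩ _ ⟨S', hS', rfl⟩
        exact ⟨Relation.Comp S (Relation.Comp R S'), hc _ hS _ (hc _ hR _ hS'),
          Relation.comp_assoc⟩)
    have hP := hc _ hR _ hS
    choose σ h1 h2 using hrefl _ hP hEE
    have hinj : Function.Injective σ := by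
      intro b b' hbb
      apply hanti _ hP hEE
      · exact ⟨σ b, h1 b, hbb ▸ h2 b'⟩
      · exact ⟨σ b', h1 b', hbb ▸ h2 b⟩
    exact ⟨Equiv.ofBijective σ (Finite.injective_iff_bijective.mp hinj), h1⟩
  intro R hR
  let gr : (M → M → Prop) → Set (M × M) := fun R => {p | R p.1 p.2}
  have hmono : ∀ R S : M → M → Prop, (∀ a b, R a b → S a b) → (gr R).ncard ≤ (gr S).ncard := by
    intro R S h
    exact Set.ncard_le_ncard (fun p hp => h _ _ hp) (Set.toFinite _)
  have heq : ∀ R S : M → M → Prop, (∀ a b, R a b → S a b) → (gr S).ncard ≤ (gr R).ncard →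
      ∀ a b, S a b → R a b := by
    intro R S h hle a b hab
    have := Set.eq_of_subset_of_ncard_le (s := gr R) (t := gr S) (fun p hp => h _ _ hp) hle
      (Set.toFinite _)
    have h' : (a, b) ∈ gr S := hab
    rw [← this] at h'; exact h'
  have hcardr : ∀ (T : M → M → Prop) (σ : Equiv.Perm M),
      (gr fun a b => T a (σ.symm b)).ncard = (gr T).ncard := by
    intro T σ
    rw [← Set.ncard_image_of_injective (gr T)
      (((Equiv.refl M).prodCongr σ).injective)]
    congr 1
    ext ⟨a, b⟩
    simp [gr]
    constructor
    · intro h; exact ⟨_, h, by simp⟩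
    · rintro ⟨c, h, rfl⟩; simpa using h
  have hcardl : ∀ (T : M → M → Prop) (σ : Equiv.Perm M),
      (gr fun a b => T (σ a) b).ncard = (gr T).ncard := by
    intro T σ
    rw [← Set.ncard_image_of_injective (gr T)
      ((σ.symm.prodCongr (Equiv.refl M)).injective)]
    congr 1
    ext ⟨a, b⟩
    simp [gr]
    constructor
    · intro h; exact ⟨_, h, by simp⟩
    · rintro ⟨c, h, rfl⟩; simpa using h
  obtain ⟨T0, hT0, hmax0⟩ := Set.exists_max_image P (fun R => (gr R).ncard) (Set.toFinite _) ⟨R, hR⟩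
  obtain ⟨T, ⟨hT, hTm⟩, hTT⟩ := rel_exists_idem {S | S ∈ P ∧ (gr T0).ncard ≤ (gr S).ncard}
    ⟨T0, hT0, le_rfl⟩ (by
      rintro S ⟨hS, hS1⟩ S' ⟨hS', _⟩
      refine ⟨hc _ hS _ hS', hS1.trans ?_⟩
      obtain ⟨σ, hσ⟩ := hperm S' hS'
      rw [← hcardr S σ]
      refine hmono (fun a b => S a (σ.symm b)) _ ?_
      intro a b h
      exact ⟨_, h, by simpa using hσ (σ.symm b)⟩)
  have hmax : ∀ S ∈ P, (gr S).ncard ≤ (gr T).ncard := fun S hS => (hmax0 S hS).trans hTm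
  have hTr := hrefl T hT hTT
  have hTa := hanti T hT hTT
  have htr : ∀ {x y z}, T x y → T y z → T x z := by
    intro x y z h1 h2
    rw [← hTT]; exact ⟨y, h1, h2⟩
  let f : M → ℕ := fun a => {c | T c a}.ncard
  have hfm : ∀ a b, T a b → f a ≤ f b := by
    intro a b h
    exact Set.ncard_le_ncard (fun c hc => htr hc h) (Set.toFinite _)
  have key : ∀ R ∈ P, ∃ σ : Equiv.Perm M, (∀ a, f (σ a) = f a) ∧
      ∀ a b, R a b → T a (σ.symm b) := by
    intro R hR
    obtain ⟨σ, hσ⟩ := hperm R hR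
    have hTRT : Relation.Comp T (Relation.Comp R T) ∈ P := hc _ hT _ (hc _ hR _ hT)
    have e1 := heq (fun a b => T a (σ.symm b)) (Relation.Comp T (Relation.Comp R T))
      (fun a b h => ⟨_, h, _, hσ _, by simpa using hTr b⟩) (by rw [hcardr]; exact hmax _ hTRT)
    have e2 := heq (fun a b => T (σ a) b) (Relation.Comp T (Relation.Comp R T))
      (fun a b h => ⟨_, hTr a, _, hσ _, h⟩) (by rw [hcardl]; exact hmax _ hTRT)
    have e3 : ∀ a b, T a b ↔ T (σ a) (σ b) := by
      intro a b
      constructor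
      · intro h
        exact e2 a (σ b) ⟨_, h, _, hσ _, hTr _⟩
      · intro h
        simpa using e1 a (σ b) ⟨_, hTr a, _, hσ _, h⟩
    refine ⟨σ, ?_, fun a b h => e1 a b ⟨_, hTr a, _, h, hTr b⟩⟩
    intro a
    show Set.ncard _ = Set.ncard _
    rw [← Set.ncard_image_of_injective {c | T c a} σ.injective]
    congr 1
    ext c
    simp only [Set.mem_ofPred_eq, Set.mem_image]
    constructor
    · intro h; exact ⟨σ.symm c, by rw [e3]; simpa using h, by simp⟩
    · rintro ⟨d, h, rfl⟩; exact (e3 _ _).1 h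
  have hfle : ∀ a b, f a ≤ f b := by
    intro a b
    obtain ⟨S, hS, hab⟩ := hi a b
    obtain ⟨σ, h1, h2⟩ := key S hS
    have := hfm _ _ (h2 a b hab)
    rw [← h1 (σ.symm b)] at this
    simpa using this
  have hTeq : ∀ a b, T a b → a = b := by
    intro a b h
    apply hTa a b h
    have : {c | T c a} = {c | T c b} :=
      Set.eq_of_subset_of_ncard_le (fun c hc => htr hc h) (hfle b a) (Set.toFinite _)
    have hb : b ∈ {c | T c b} := hTr b
    rw [← this] at hb; exact hb
  obtain ⟨σ, -, h2⟩ := key R hR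
  constructor
  · intro a a' b h h'
    rw [hTeq _ _ (h2 _ _ h), hTeq _ _ (h2 _ _ h')]
  · intro a b b' h h'
    exact σ.symm.injective ((hTeq _ _ (h2 _ _ h)).symm.trans (hTeq _ _ (h2 _ _ h')))

/-- A path over `y` from `a` at time `s` to `b` at time `e`. -/
def YPath (X : Set (ℤ → A)) (Φ : A → B) (y : ℤ → B) (s e : ℤ) (a b : A) : Prop :=
  ∃ v ∈ X, v s = a ∧ v e = b ∧ ∀ m, s ≤ m → m ≤ e → Φ (v m) = y m

theorem glue_mem (X : Set (ℤ → A)) (T : A → A → Prop)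
    (hX : X = {x | ∀ i : ℤ, T (x i) (x (i + 1))}) {x x' : ℤ → A} (hx : x ∈ X) (hx' : x' ∈ X)
    (k : ℤ) (h : x k = x' k) : (fun m => if m ≤ k then x m else x' m) ∈ X := by
  subst hX
  intro i
  have h1 := hx i
  have h2 := hx' i
  show T (if i ≤ k then x i else x' i) (if i + 1 ≤ k then x (i + 1) else x' (i + 1))
  by_cases hi : i + 1 ≤ k
  · rw [if_pos hi, if_pos (by omega)]; exact h1
  · rw [if_neg hi]
    by_cases hi' : i ≤ k
    · have : i = k := by omega
      subst this
      rw [if_pos le_rfl, h]; exact h2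
    · rw [if_neg hi']; exact h2

theorem YPath.trans {X : Set (ℤ → A)} {T : A → A → Prop}
    (hX : X = {x | ∀ i : ℤ, T (x i) (x (i + 1))}) {Φ : A → B} {y : ℤ → B} {s t e : ℤ}
    {a b c : A} (h1 : YPath X Φ y s t a b) (h2 : YPath X Φ y t e b c) (hst : s ≤ t) (hte : t ≤ e) :
    YPath X Φ y s e a c := by
  obtain ⟨v, hv, v1, v2, v3⟩ := h1
  obtain ⟨u, hu, u1, u2, u3⟩ := h2
  refine ⟨_, glue_mem X T hX hv hu t (v2.trans u1.symm), ?_, ?_, ?_⟩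
  · show (if s ≤ t then v s else u s) = a
    rw [if_pos hst, v1]
  · show (if e ≤ t then v e else u e) = c
    split_ifs with h
    · have : e = t := le_antisymm h hte
      subst this
      rw [v2, ← u1, u2]
    · exact u2
  · intro m h1 h2
    show Φ (if m ≤ t then v m else u m) = _
    split_ifs with h
    · exact v3 m h1 h
    · exact u3 m (by omega) h2

theorem YPath.shift {X : Set (ℤ → A)} (hsh : ∀ n : ℤ, ∀ x ∈ X, shiftMap n x ∈ X)
    {Φ : A → B} {y y' : ℤ → B} {s e : ℤ} {a b : A} (h : YPath X Φ y s e a b) (k : ℤ)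
    {s' e' : ℤ} (hs : s' = s + k) (he : e' = e + k)
    (hy : ∀ m, s ≤ m → m ≤ e → y' (m + k) = y m) : YPath X Φ y' s' e' a b := by
  subst hs he
  obtain ⟨v, hv, v1, v2, v3⟩ := h
  refine ⟨shiftMap (-k) v, hsh _ _ hv, ?_, ?_, ?_⟩
  · simp [shiftMap, v1]
  · simp [shiftMap, v2]
  · intro m h1 h2
    have := hy (m + -k) (by omega) (by omega)
    simp only [shiftMap]
    rw [v3 _ (by omega) (by omega), ← this]
    congr 1; omega

theorem ypath_of_point {X : Set (ℤ → A)} {Φ : A → B} {y : ℤ → B} {x : ℤ → A} (hx : x ∈ X)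
    (s e : ℤ) (h : ∀ m, s ≤ m → m ≤ e → Φ (x m) = y m) : YPath X Φ y s e (x s) (x e) :=
  ⟨x, hx, rfl, rfl, h⟩

/-- `w` occurs in `y` at position `q`. -/
def OccAt {p : ℕ} (w : Fin (p + 1) → B) (y : ℤ → B) (q : ℤ) : Prop :=
  ∀ j : Fin (p + 1), y (q + (j.1 : ℤ)) = w j

theorem ypath_route {X : Set (ℤ → A)} (hsh : ∀ n : ℤ, ∀ x ∈ X, shiftMap n x ∈ X)
    {T : A → A → Prop} (hX : X = {x | ∀ i : ℤ, T (x i) (x (i + 1))})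
    {Y : Set (ℤ → B)} {Φ : A → B} {p : ℕ} {w : Fin (p + 1) → B} {n : Fin (p + 1)} {M : Set A}
    (hw : IsTransBlock X Y Φ w n M) {y : ℤ → B} {q : ℤ} (hq : OccAt w y q) {s e : ℤ}
    (hs : s ≤ q) (he : q + p ≤ e) {a b : A} (h : YPath X Φ y s e a b) :
    ∃ c ∈ M, YPath X Φ y s (q + n.1) a c ∧ YPath X Φ y (q + n.1) e c b := by
  obtain ⟨v, hv, rfl, rfl, v3⟩ := h
  obtain ⟨-, hn0, hnp, -, hr⟩ := hw
  obtain ⟨c, hc, u', ⟨⟨x, hx, i, hxi⟩, hu'⟩, h0, hl, hn⟩ :=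
    hr (fun j => v (q + (j.1 : ℤ))) ⟨⟨v, hv, q, fun j => rfl⟩, fun j => by
      rw [← hq j]
      have := j.2
      exact v3 _ (by omega) (by omega)⟩
  have hval : ∀ j : Fin (p + 1), Φ (x (i + (j.1 : ℤ))) = y (q + (j.1 : ℤ)) := by
    intro j; rw [hxi, hu', hq]
  have hover : ∀ m, i ≤ m → m ≤ i + p → y (m + (q - i)) = Φ (x m) := by
    intro m h1 h2
    have := hval ⟨(m - i).toNat, by omega⟩
    have e1 : i + (((m - i).toNat : ℕ) : ℤ) = m := by omega
    have e2 : q + (((m - i).toNat : ℕ) : ℤ) = m + (q - i) := by omega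
    simp only [e1, e2] at this
    exact this.symm
  have xi0 : x i = v q := by
    have := hxi 0; simp at this; rw [this, h0]; simp
  have xil : x (i + p) = v (q + p) := by
    have := hxi (Fin.last p); simp at this; rw [this, hl]; simp
  have xin : x (i + n.1) = c := by rw [hxi n, hn]
  have p1 : YPath X Φ y q (q + n.1) (v q) c := by
    have := (ypath_of_point (y := fun m => Φ (x m)) (Φ := Φ) hx i (i + n.1) (fun _ _ _ => rfl)).shift hsh
      (y' := y) (q - i) (s' := q) (e' := q + n.1) (by omega) (by omega)
      (fun m h1 h2 => hover m h1 (by omega))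
    rwa [xi0, xin] at this
  have p2 : YPath X Φ y (q + n.1) (q + p) c (v (q + p)) := by
    have := (ypath_of_point (y := fun m => Φ (x m)) (Φ := Φ) hx (i + n.1) (i + p) (fun _ _ _ => rfl)).shift hsh
      (y' := y) (q - i) (s' := q + n.1) (e' := q + p) (by omega) (by omega)
      (fun m h1 h2 => hover m (by omega) (by omega))
    rwa [xil, xin] at this
  refine ⟨c, hc, ?_, ?_⟩
  · exact (ypath_of_point hv s q fun m h1 h2 => v3 m h1 (by omega)).trans hX p1 hs (by omega)
  · exact p2.trans hX (ypath_of_point hv (q + p) e fun m h1 h2 => v3 m (by omega) h2)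
      (by omega) he

theorem ypath_star [Finite A] {X : Set (ℤ → A)} (hsh : ∀ n : ℤ, ∀ x ∈ X, shiftMap n x ∈ X)
    {T : A → A → Prop} (hX : X = {x | ∀ i : ℤ, T (x i) (x (i + 1))})
    {Y : Set (ℤ → B)} {Φ : A → B} {p : ℕ} {w : Fin (p + 1) → B} {n : Fin (p + 1)} {M : Set A}
    (hw : IsMinTransBlock X Y Φ w n M) {y : ℤ → B} (hy : y ∈ Y) {q : ℤ} (hq : OccAt w y q)
    {s e : ℤ} (hs : s ≤ q) (he : q + p ≤ e) {b : A} (hb : b ∈ M) :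
    ∃ α β, YPath X Φ y s (q + n.1) α b ∧ YPath X Φ y (q + n.1) e b β ∧
      ∀ b' ∈ M, YPath X Φ y s (q + n.1) α b' → YPath X Φ y (q + n.1) e b' β → b' = b := by
  by_contra hcon
  push Not at hcon
  have hwT := hw.1
  obtain ⟨-, hn0, hnp, hMw, -⟩ := hw.1
  obtain ⟨L, hL⟩ : ∃ L : ℕ, e = s + L := ⟨(e - s).toNat, by omega⟩
  obtain ⟨N, hN⟩ : ∃ N : ℕ, q + n.1 = s + N := ⟨(q + n.1 - s).toNat, by omega⟩
  have hNL : N < L + 1 := by omega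
  have hblock : IsTransBlock X Y Φ (p := L) (fun j => y (s + (j.1 : ℤ))) ⟨N, hNL⟩ (M \ {b}) := by
    refine ⟨⟨y, hy, s, fun j => rfl⟩, ?_, ?_, ?_, ?_⟩
    · show 0 < N
      omega
    · show N < L
      omega
    · rintro a ⟨ha, -⟩
      show Φ a = y (s + (N : ℤ))
      rw [hMw a ha, ← hN, hq n]
    · rintro u ⟨⟨x, hx, i, hxi⟩, hu⟩
      have hover : ∀ m, i ≤ m → m ≤ i + L → y (m + (s - i)) = Φ (x m) := by
        intro m h1 h2
        have h3 := hu ⟨(m - i).toNat, by omega⟩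
        rw [← hxi] at h3
        have e1 : i + (((m - i).toNat : ℕ) : ℤ) = m := by omega
        have e2 : s + (((m - i).toNat : ℕ) : ℤ) = m + (s - i) := by omega
        simp only [e1, e2] at h3
        exact h3.symm
      have P0 : YPath X Φ y s e (x i) (x (i + L)) :=
        (ypath_of_point (y := fun m => Φ (x m)) (Φ := Φ) hx i (i + L) (fun _ _ _ => rfl)).shift hsh
          (y' := y) (s - i) (by omega) (by omega) hover
      obtain ⟨c, hc, P1, P2⟩ := ypath_route hsh hX hwT hq hs he P0
      obtain ⟨c', hc', hne, P3, P4⟩ : ∃ c' ∈ M, c' ≠ b ∧ YPath X Φ y s (q + n.1) (x i) c' ∧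
          YPath X Φ y (q + n.1) e c' (x (i + L)) := by
        by_cases hcb : c = b
        · subst hcb
          obtain ⟨b', hb', h1, h2, h3⟩ := hcon _ _ P1 P2
          exact ⟨b', hb', h3, h1, h2⟩
        · exact ⟨c, hc, hcb, P1, P2⟩
      obtain ⟨v, hv, v1, v2, v3⟩ := P3
      obtain ⟨v', hv', v1', v2', v3'⟩ := P4
      have hg := glue_mem X T hX hv hv' (q + n.1) (v2.trans v1'.symm)
      refine ⟨c', ⟨hc', hne⟩, fun j => if s + (j.1 : ℤ) ≤ q + n.1 then v (s + (j.1 : ℤ)) else v' (s + (j.1 : ℤ)), ⟨⟨_, hg, s, fun j => rfl⟩, ?_⟩, ?_, ?_, ?_⟩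
      · intro j
        have := j.2
        show Φ (if s + (j.1 : ℤ) ≤ q + n.1 then v (s + (j.1 : ℤ)) else v' (s + (j.1 : ℤ))) = _
        split_ifs with h
        · exact v3 _ (by omega) h
        · exact v3' _ (by omega) (by omega)
      · have hx0 := hxi 0
        simp only [Fin.val_zero, Nat.cast_zero, add_zero] at hx0 ⊢
        rw [if_pos (by omega), v1, hx0]
      · have hxl := hxi (Fin.last L)
        simp only [Fin.val_last] at hxl ⊢
        rw [if_neg (by omega), ← hL, v2', hxl]
      · show (if s + (N : ℤ) ≤ q + n.1 then v (s + (N : ℤ)) else v' (s + (N : ℤ))) = c'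
        rw [if_pos (by omega), ← hN, v2]
  have hle : minDepth X Y Φ ≤ Nat.card (M \ {b} : Set A) :=
    Nat.sInf_le ⟨L, _, _, _, hblock, rfl⟩
  rw [← hw.2] at hle
  simp only [Nat.card_coe_set_eq] at hle
  have h2 := Set.ncard_sdiff_singleton_lt_of_mem hb (Set.toFinite M)
  omega

theorem ypath_glue {X : Set (ℤ → A)} (hsh : ∀ n : ℤ, ∀ x ∈ X, shiftMap n x ∈ X)
    {T : A → A → Prop} (hX : X = {x | ∀ i : ℤ, T (x i) (x (i + 1))})
    {Y : Set (ℤ → B)} {Φ : A → B} (hY : ∀ x ∈ X, (fun m => Φ (x m)) ∈ Y)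
    {y1 y2 : ℤ → B} {s t t2 e : ℤ} {a b c : A} (h1 : YPath X Φ y1 s t a b)
    (h2 : YPath X Φ y2 t2 e b c) :
    ∃ y ∈ Y, (∀ m, s ≤ m → m ≤ t → y m = y1 m) ∧
      ∀ m, t2 ≤ m → m ≤ e → y (m + (t - t2)) = y2 m := by
  obtain ⟨v, hv, v1, v2, v3⟩ := h1
  obtain ⟨u, hu, u1, u2, u3⟩ := h2
  have hg := glue_mem X T hX hv (hsh (t2 - t) u hu) t (by simp [shiftMap, v2, u1])
  refine ⟨_, hY _ hg, ?_, ?_⟩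
  · intro m hm hm'
    show Φ (if m ≤ t then _ else _) = _
    rw [if_pos hm', v3 m hm hm']
  · intro m hm hm'
    show Φ (if m + (t - t2) ≤ t then v (m + (t - t2)) else u (m + (t - t2) + (t2 - t))) = _
    split_ifs with h
    · have : m = t2 := by omega
      subst this
      rw [show m + (t - m) = t by ring, v2, ← u1]
      exact u3 m le_rfl hm'
    · rw [show m + (t - t2) + (t2 - t) = m by ring]
      exact u3 m hm hm'

theorem OccAt.apply {p : ℕ} {w : Fin (p + 1) → B} {y y' : ℤ → B} {q q' : ℤ} (h : OccAt w y q)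
    (h' : OccAt w y' q') (m : ℤ) (h0 : q ≤ m) (h1 : m ≤ q + p) : y m = y' (m + (q' - q)) := by
  have a1 := h ⟨(m - q).toNat, by omega⟩
  have a2 := h' ⟨(m - q).toNat, by omega⟩
  simp only at a1 a2
  rw [show q + (((m - q).toNat : ℕ) : ℤ) = m by omega] at a1
  rw [show q' + (((m - q).toNat : ℕ) : ℤ) = m + (q' - q) by omega] at a2
  rw [a1, a2]

theorem OccAt.congr {p : ℕ} {w : Fin (p + 1) → B} {y y' : ℤ → B} {q q' : ℤ} (h : OccAt w y q)
    (hy : ∀ m, q ≤ m → m ≤ q + p → y' (m + (q' - q)) = y m) : OccAt w y' q' := by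
  intro j
  have := j.2
  rw [← h j, ← hy _ (by omega) (by omega)]
  congr 1; ring

/-- The routing relation on `M` between two occurrences of `w` in `y`. -/
def RouteRel (X : Set (ℤ → A)) (Φ : A → B) (M : Set A) (n : ℕ) (y : ℤ → B) (q q' : ℤ) :
    M → M → Prop := fun a b => YPath X Φ y (q + n) (q' + n) a.1 b.1

theorem route_bij [Finite A] [TopologicalSpace A]
    {X : Set (ℤ → A)} (hsh : ∀ n : ℤ, ∀ x ∈ X, shiftMap n x ∈ X)
    (hirr : IrreducibleSubshift X)
    {T : A → A → Prop} (hX : X = {x | ∀ i : ℤ, T (x i) (x (i + 1))})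
    {Y : Set (ℤ → B)} {Φ : A → B} (hY : ∀ x ∈ X, (fun m => Φ (x m)) ∈ Y)
    {p : ℕ} {w : Fin (p + 1) → B} {n : Fin (p + 1)} {M : Set A}
    (hw : IsMinTransBlock X Y Φ w n M) {y : ℤ → B} (hy : y ∈ Y) {q q' : ℤ} (hq : OccAt w y q)
    (hq' : OccAt w y q') (hqq : q + p ≤ q') :
    (∀ a a' b, RouteRel X Φ M n.1 y q q' a b → RouteRel X Φ M n.1 y q q' a' b → a = a') ∧
    (∀ a b b', RouteRel X Φ M n.1 y q q' a b → RouteRel X Φ M n.1 y q q' a b' → b = b') := by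
  have hnp := hw.1.2.2.1
  let P : Set (M → M → Prop) := {R | ∃ y ∈ Y, ∃ q q' : ℤ, OccAt w y q ∧ OccAt w y q' ∧
    q + p ≤ q' ∧ R = RouteRel X Φ M n.1 y q q'}
  have hglue : ∀ R ∈ P, ∀ S ∈ P, M.Nonempty → ∃ y ∈ Y, ∃ q1 q2 q3 : ℤ, OccAt w y q1 ∧
      OccAt w y q2 ∧ OccAt w y q3 ∧ q1 + p ≤ q2 ∧ q2 + p ≤ q3 ∧
      R = RouteRel X Φ M n.1 y q1 q2 ∧ S = RouteRel X Φ M n.1 y q2 q3 := by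
    rintro R ⟨y1, hy1, q1, q1', o1, o1', l1, rfl⟩ S ⟨y2, hy2, q2, q2', o2, o2', l2, rfl⟩ ⟨b, hb⟩
    obtain ⟨α, β, Pa, -, -⟩ := ypath_star hsh hX hw hy1 o1' (s := q1) (e := q1' + p)
      (by omega) le_rfl hb
    obtain ⟨α', β', -, Pb, -⟩ := ypath_star hsh hX hw hy2 o2 (s := q2) (e := q2' + p)
      le_rfl (by omega) hb
    obtain ⟨y, hy, g1, g2⟩ := ypath_glue hsh hX hY Pa Pb
    have hk : q1' + (n.1 : ℤ) - (q2 + n.1) = q1' - q2 := by ring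
    rw [hk] at g2
    have g1' : ∀ m, q1 ≤ m → m ≤ q1' + p → y m = y1 m := by
      intro m h1 h2
      by_cases h : m ≤ q1' + n.1
      · exact g1 m h1 h
      · have := g2 (m - (q1' - q2)) (by omega) (by omega)
        rw [sub_add_cancel] at this
        rw [this, o1'.apply o2 m (by omega) (by omega)]
        congr 1; ring
    have g2' : ∀ m, q2 ≤ m → m ≤ q2' + p → y (m + (q1' - q2)) = y2 m := by
      intro m h1 h2
      by_cases h : q2 + n.1 ≤ m
      · exact g2 m h h2
      · rw [g1 _ (by omega) (by omega)]
        exact (o2.apply o1' m h1 (by omega)).symm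
    refine ⟨y, hy, q1, q1', q2' + (q1' - q2), ?_, ?_, ?_, l1, by omega, ?_, ?_⟩
    · exact o1.congr fun m h1 h2 => by simpa using g1' m h1 (by omega)
    · exact o1'.congr fun m h1 h2 => by simpa using g1' m (by omega) h2
    · exact o2'.congr fun m h1 h2 => by
        rw [show m + (q2' + (q1' - q2) - q2') = m + (q1' - q2) by ring]
        exact g2' m (by omega) h2
    · funext a b
      apply propext
      constructor
      · intro h
        exact YPath.shift hsh h 0 (by ring) (by ring)
          fun m h1 h2 => by simpa using g1' m (by omega) (by omega)
      · intro h
        exact YPath.shift hsh h 0 (by ring) (by ring)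
          fun m h1 h2 => by simpa using (g1' m (by omega) (by omega)).symm
    · funext a b
      apply propext
      constructor
      · intro h
        exact YPath.shift hsh h (q1' - q2) (by ring) (by ring)
          fun m h1 h2 => g2' m (by omega) (by omega)
      · intro h
        refine YPath.shift hsh h (-(q1' - q2)) (by ring) (by ring) fun m h1 h2 => ?_
        rw [← g2' _ (by omega) (by omega)]
        congr 1; ring
  refine rel_abs P ?_ ?_ ?_ _ ⟨y, hy, q, q', hq, hq', hqq, rfl⟩
  · intro R hR S hS
    by_cases hM : M.Nonempty
    · obtain ⟨y, hy, q1, q2, q3, o1, o2, o3, l1, l2, rfl, rfl⟩ := hglue R hR S hS hM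
      refine ⟨y, hy, q1, q3, o1, o3, by omega, ?_⟩
      funext a c
      apply propext
      constructor
      · rintro ⟨b, h1, h2⟩
        exact YPath.trans hX h1 h2 (by omega) (by omega)
      · intro h
        obtain ⟨b, hb, h1, h2⟩ := ypath_route hsh hX hw.1 o2 (by omega) (by omega) h
        exact ⟨⟨b, hb⟩, h1, h2⟩
    · have : Relation.Comp R S = R := by
        funext a
        exact absurd ⟨a.1, a.2⟩ hM
      rw [this]; exact hR
  · rintro R hR S hS ⟨b, hb⟩
    obtain ⟨y, hy, q1, q2, q3, o1, o2, o3, l1, l2, rfl, rfl⟩ := hglue R hR S hS ⟨b, hb⟩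
    obtain ⟨α, β, Pa, Pb, huniq⟩ := ypath_star hsh hX hw hy o2 (s := q1) (e := q3 + p)
      (by omega) (by omega) hb
    obtain ⟨a, ha, Pa1, Pa2⟩ := ypath_route hsh hX hw.1 o1 le_rfl (by omega) Pa
    obtain ⟨c, hc, Pb1, Pb2⟩ := ypath_route hsh hX hw.1 o3 (by omega) le_rfl Pb
    refine ⟨⟨a, ha⟩, ⟨c, hc⟩, Pa2, Pb1, ?_⟩
    rintro ⟨b', hb'⟩ h1 h2
    apply Subtype.ext
    exact huniq b' hb' (Pa1.trans hX h1 (by omega) (by omega))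
      (YPath.trans hX h2 Pb2 (by omega) (by omega))
  · rintro ⟨a, ha⟩ ⟨b, hb⟩
    have hpre : ∀ a ∈ M, ∃ u : Fin (p + 1) → A, OccursIn u X ∧ (∀ j, Φ (u j) = w j) ∧ u n = a := by
      intro a ha
      obtain ⟨α, β, Pa, Pb, -⟩ := ypath_star hsh hX hw hy hq (s := q) (e := q + p)
        le_rfl le_rfl ha
      obtain ⟨v, hv, v1, v2, v3⟩ := Pa
      obtain ⟨v', hv', v1', v2', v3'⟩ := Pb
      have hg := glue_mem X T hX hv hv' (q + n.1) (v2.trans v1'.symm)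
      refine ⟨_, ⟨_, hg, q, fun j => rfl⟩, ?_, ?_⟩
      · intro j
        have := j.2
        rw [← hq j]
        try dsimp only
        split_ifs with h
        · exact v3 _ (by omega) h
        · exact v3' _ (by omega) (by omega)
      · simp [v2]
    obtain ⟨u, hu, hu1, hu2⟩ := hpre a ha
    obtain ⟨u', hu', hu1', hu2'⟩ := hpre b hb
    obtain ⟨x, hx, i, k, hik, hi, hk⟩ := hirr _ _ u u' hu hu'
    refine ⟨_, ⟨fun m => Φ (x m), hY x hx, i, k, ?_, ?_, ?_, rfl⟩, ?_⟩
    · intro j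
      show Φ (x _) = _
      rw [hi, hu1]
    · intro j
      show Φ (x _) = _
      rw [hk, hu1']
    · push_cast at hik
      omega
    · exact ⟨x, hx, by rw [hi n, hu2], by rw [hk n, hu2'], fun _ _ _ => rfl⟩

theorem TransitionTo.trans' {X : Set (ℤ → A)} {T : A → A → Prop}
    (hX : X = {x | ∀ i : ℤ, T (x i) (x (i + 1))}) {π : (ℤ → A) → ℤ → B} {Φ : A → B}
    (hΦ : OneBlockRule π Φ) {x1 x2 x3 : ℤ → A} (h12 : π x1 = π x2)
    (h1 : TransitionTo X π x1 x2) (h2 : TransitionTo X π x2 x3) : TransitionTo X π x1 x3 := by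
  intro n
  obtain ⟨u, hu, hu1, hu2, i, hni, hu3⟩ := h1 n
  obtain ⟨v, hv, hv1, hv2, j, hij, hv3⟩ := h2 i
  have hg := glue_mem X T hX hu hv i (by rw [hu3 i le_rfl, hv2 i le_rfl])
  refine ⟨_, hg, ?_, ?_, j + 1, by omega, ?_⟩
  · funext m
    rw [hΦ]
    try dsimp only
    split_ifs
    · rw [← hΦ, hu1]
    · rw [← hΦ, hv1, h12]
  · intro m hm
    try dsimp only
    rw [if_pos (by omega), hu2 m hm]
  · intro m hm
    try dsimp only
    rw [if_neg (by omega), hv3 m (by omega)]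

theorem transClass_eq {X : Set (ℤ → A)} {T : A → A → Prop}
    (hX : X = {x | ∀ i : ℤ, T (x i) (x (i + 1))}) {π : (ℤ → A) → ℤ → B} {Φ : A → B}
    (hΦ : OneBlockRule π Φ) {x1 x2 : ℤ → A} (h12 : π x1 = π x2)
    (h : TransEquiv X π x1 x2) : transClass X π x1 = transClass X π x2 := by
  ext x
  constructor
  · rintro ⟨h1, h2, h3, h4⟩
    exact ⟨h1, h2.trans h12, h.2.trans' hX hΦ h12.symm h3, h4.trans' hX hΦ h2 h.1⟩
  · rintro ⟨h1, h2, h3, h4⟩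
    exact ⟨h1, h2.trans h12.symm, h.1.trans' hX hΦ h12 h3, h4.trans' hX hΦ h2 h.2⟩

theorem transitionTo_of_paths {X : Set (ℤ → A)} {T : A → A → Prop}
    (hX : X = {x | ∀ i : ℤ, T (x i) (x (i + 1))}) {π : (ℤ → A) → ℤ → B} {Φ : A → B}
    (hΦ : OneBlockRule π Φ) {x1 x2 : ℤ → A} (hx1 : x1 ∈ X) (hx2 : x2 ∈ X) {y : ℤ → B}
    (h1 : π x1 = y) (h2 : π x2 = y)
    (h : ∀ n : ℤ, ∃ s e, n ≤ s ∧ s ≤ e ∧ YPath X Φ y s e (x1 s) (x2 e)) :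
    TransitionTo X π x1 x2 := by
  intro n
  obtain ⟨s, e, hs, hse, v, hv, v1, v2, v3⟩ := h n
  have hg := glue_mem X T hX hx1 hv s v1.symm
  have hg2 := glue_mem X T hX hg hx2 e (by
    try dsimp only
    split_ifs with h
    · have : e = s := le_antisymm h hse
      subst this; rw [← v1, v2]
    · exact v2)
  refine ⟨_, hg2, ?_, ?_, e + 1, by omega, ?_⟩
  · funext m
    rw [hΦ]
    try dsimp only
    rw [h1]
    split_ifs with c1 c2
    · rw [← hΦ x1, h1]
    · exact v3 m (by omega) c1
    · rw [← hΦ x2, h2]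
  · intro m hm
    try dsimp only
    rw [if_pos (by omega), if_pos (by omega)]
  · intro m hm
    try dsimp only
    rw [if_neg (by omega)]

theorem occ_right {p : ℕ} {Y : Set (ℤ → B)} (hsh : ∀ n : ℤ, ∀ x ∈ Y, shiftMap n x ∈ Y)
    {w : Fin (p + 1) → B} (hw : OccursIn w Y) {y : ℤ → B} (hy : RightTransitive Y y) (K : ℤ) :
    ∃ q, K ≤ q ∧ OccAt w y q := by
  obtain ⟨x, hx, i, hi⟩ := hw
  obtain ⟨k, hk, hk'⟩ := hy.2 _ (hsh (i - K) x hx) (K.natAbs + p)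
  refine ⟨K + k, by omega, ?_⟩
  intro j
  have hj := j.2
  have := hk' (K + j.1) (by rw [abs_le]; constructor <;> omega)
  rw [← hi j, show K + k + (j.1 : ℤ) = K + j.1 + k by ring, this]
  simp only [shiftMap]
  congr 1; ring

theorem symbols_once_separated_cannot_meet_again [Fintype A] [TopologicalSpace A] [DiscreteTopology A]
    [Fintype B] [TopologicalSpace B] [DiscreteTopology B]
    (X : Set (ℤ → A)) (Y : Set (ℤ → B)) (π : (ℤ → A) → ℤ → B) (Φ : A → B)
    (hT : FactorTriple X Y π) (hXirr : IrreducibleSubshift X)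
    (hX1 : IsOneStep X) (hΦ : OneBlockRule π Φ)
    (y : ℤ → B) (hy : RightTransitive Y y)
    (hblk : ∃ (p : ℕ) (w : Fin (p + 1) → B) (n : Fin (p + 1)) (M : Set A) (i0 : ℤ),
      IsMinTransBlock X Y Φ w n M ∧ i0 + (p : ℤ) + 1 ≤ 0 ∧
        ∀ j : Fin (p + 1), y (i0 + (j.1 : ℤ)) = w j) :
    ∀ z : ℤ → B, RightTransitive Y z → ∀ i : ℤ, z i = y 0 →
      ∀ D ∈ transClassesOver X π z,
        {C | C ∈ transClassesOver X π y ∧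
          ∃ x ∈ D, ∃ x' ∈ C, x i = x' 0}.Subsingleton := by
  obtain ⟨⟨-, hsh⟩, T, hX⟩ := hX1
  obtain ⟨-, ⟨-, hshY⟩, -, hXY, -⟩ := hT
  have hπ : ∀ x, π x = fun m => Φ (x m) := fun x => funext fun m => hΦ x m
  have hY : ∀ x ∈ X, (fun m => Φ (x m)) ∈ Y := fun x hx => hπ x ▸ hXY x hx
  obtain ⟨p, w, n, M, i0, hw, hi0, hocc⟩ := hblk
  have hocc : OccAt w y i0 := hocc
  have hnp := hw.1.2.2.1
  have hpt : ∀ {y x}, x ∈ X → π x = y → ∀ s e, YPath X Φ y s e (x s) (x e) := by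
    rintro _ x hx rfl s e
    exact ypath_of_point hx s e fun m _ _ => (hΦ x m).symm
  rintro z hz i hzi D ⟨x0, hx0, hx0z, rfl⟩ C1 ⟨⟨c1, hc1, hc1y, rfl⟩, x1, ⟨hx1, hx1z, hx1t⟩, x1', ⟨hx1', hx1y, hx1't⟩, e1⟩
    C2 ⟨⟨c2, hc2, hc2y, rfl⟩, x2, ⟨hx2, hx2z, hx2t⟩, x2', ⟨hx2', hx2y, hx2't⟩, e2⟩
  rw [transClass_eq hX hΦ hx1y.symm hx1't, transClass_eq hX hΦ hx2y.symm hx2't]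
  rw [hc1y] at hx1y
  rw [hc2y] at hx2y
  have h12 : TransitionTo X π x1 x2 := hx1t.2.trans' hX hΦ hx1z hx2t.1
  rw [hx0z] at hx1z hx2z
  obtain ⟨b1, hb1, -, Q1⟩ := ypath_route hsh hX hw.1 hocc le_rfl (by omega)
    (hpt hx1' hx1y i0 0)
  obtain ⟨b2, hb2, -, Q2⟩ := ypath_route hsh hX hw.1 hocc le_rfl (by omega)
    (hpt hx2' hx2y i0 0)
  have hbb : b1 = b2 := by
    obtain ⟨u, hu, hu1, hu2, e, hie, hu3⟩ := h12 i
    obtain ⟨q, hq, hoq⟩ := occ_right hshY hw.1.1 hz (max e (i + 1))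
    have hqe : e ≤ q := le_trans (le_max_left _ _) hq
    have hqi : i + 1 ≤ q := le_trans (le_max_right _ _) hq
    obtain ⟨c, hc, R1, R2⟩ := ypath_route hsh hX hw.1 hoq le_rfl le_rfl (hpt hx2 hx2z q (q + p))
    have S2 : YPath X Φ z i (q + n.1) (x2 i) c :=
      (hpt hx2 hx2z i q).trans hX R1 (by omega) (by omega)
    have S1 : YPath X Φ z i (q + n.1) (x1 i) c := by
      have := hpt hu (hu1.trans hx1z) i q
      rw [hu2 i le_rfl, hu3 q hqe] at this
      exact this.trans hX R1 (by omega) (by omega)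
    have G2 : YPath X Φ z i (q + p) (x1' 0) (x2 (q + p)) := by
      rw [← e1]; exact S1.trans hX R2 (by omega) (by omega)
    have G1 := hpt hx1' hx1y i0 0
    obtain ⟨yy, hyy, g1, g2⟩ := ypath_glue hsh hX hY G1 G2
    have oo1 : OccAt w yy i0 := hocc.congr fun m h1 h2 => by
      simpa using g1 m h1 (by omega)
    have oo2 : OccAt w yy (q - i) := hoq.congr fun m h1 h2 => by
      rw [← g2 m (by omega) h2]; congr 1; ring
    have hbij := (route_bij hsh hXirr hX hY hw hyy oo1 oo2 (by omega)).1
    have K1 : ∀ b a, YPath X Φ y (i0 + n.1) 0 b a → YPath X Φ z i (q + n.1) a c →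
        YPath X Φ yy (i0 + n.1) (q - i + n.1) b c := by
      intro b a h1 h2
      have h1' : YPath X Φ yy (i0 + n.1) 0 b a := h1.shift hsh 0 (by ring) (by ring)
        fun m h1 h2 => by simpa using g1 m (by omega) h2
      have h2' : YPath X Φ yy 0 (q - i + n.1) a c := h2.shift hsh (0 - i) (by ring) (by ring)
        fun m h1 h2 => g2 m h1 (by omega)
      exact h1'.trans hX h2' (by omega) (by omega)
    have := hbij ⟨b1, hb1⟩ ⟨b2, hb2⟩ ⟨c, hc⟩ (K1 _ _ Q1 (by rw [← e1]; exact S1))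
      (K1 _ _ Q2 (by rw [← e2]; exact S2))
    exact congrArg Subtype.val this
  subst hbb
  have hyx : π x1' = π x2' := hx1y.trans hx2y.symm
  have hmeet : ∀ N : ℤ, ∃ q c, N ≤ q ∧ YPath X Φ y q (q + n.1) (x1' q) c ∧
      YPath X Φ y q (q + n.1) (x2' q) c ∧ YPath X Φ y (q + n.1) (q + p) c (x1' (q + p)) ∧
      YPath X Φ y (q + n.1) (q + p) c (x2' (q + p)) := by
    intro N
    obtain ⟨q, hq, hoq⟩ := occ_right hshY hw.1.1 hy (max N 0)
    have hqN : N ≤ q := le_trans (le_max_left _ _) hq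
    have hq0 : 0 ≤ q := le_trans (le_max_right _ _) hq
    obtain ⟨d1, hd1, R1, R1'⟩ := ypath_route hsh hX hw.1 hoq le_rfl le_rfl (hpt hx1' hx1y q (q + p))
    obtain ⟨d2, hd2, R2, R2'⟩ := ypath_route hsh hX hw.1 hoq le_rfl le_rfl (hpt hx2' hx2y q (q + p))
    have hbij := (route_bij hsh hXirr hX hY hw hy.1 hocc hoq (by omega)).2
    have := hbij ⟨b1, hb1⟩ ⟨d1, hd1⟩ ⟨d2, hd2⟩
      ((Q1.trans hX (hpt hx1' hx1y 0 q) (by omega) hq0).trans hX R1 (by omega) (by omega))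
      ((Q2.trans hX (hpt hx2' hx2y 0 q) (by omega) hq0).trans hX R2 (by omega) (by omega))
    have hd : d1 = d2 := congrArg Subtype.val this
    subst hd
    exact ⟨q, d1, hqN, R1, R2, R1', R2'⟩
  apply transClass_eq hX hΦ hyx
  constructor
  · apply transitionTo_of_paths hX hΦ hx1' hx2' hx1y hx2y
    intro N
    obtain ⟨q, c, hq, h1, h2, h3, h4⟩ := hmeet N
    exact ⟨q, q + p, hq, by omega, h1.trans hX h4 (by omega) (by omega)⟩
  · apply transitionTo_of_paths hX hΦ hx2' hx1' hx2y hx1y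
    intro N
    obtain ⟨q, c, hq, h1, h2, h3, h4⟩ := hmeet N
    exact ⟨q, q + p, hq, by omega, h2.trans hX h3 (by omega) (by omega)⟩
end
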